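/- Let γ : [0,1] → ℝ², γ = (u,v), be a C¹ closed curve (γ(0) = γ(1)) whose image is disjoint from all circles C_1,…,C_n and from all centers p_1,…,p_n. Then ∫₀¹ [−Q_T(γ(t)) u'(t) + P_T(γ(t)) v'(t)] / (A(γ(t)) B(γ(t))) dt = 2 Σ_{j=1}^r ∫₀¹ [(u(t)−x_j) v'(t) − (v(t)−y_j) u'(t)] / g_j(γ(t)) dt. In particular, if γ is a counterclockwise parametrization of a round circle whose open disc contains exactly s of the primary centers p_1,…,p_r, the left-hand integral equals 4πs. -/

import Mathlib

open MvPolynomial Function Set Filter Real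
open scoped Classical

noncomputable section

/-- Bivariate real polynomials, representing components of planar polynomial vector fields. -/
abbrev Poly2 := MvPolynomial (Fin 2) ℝ

/-- Evaluation of a bivariate polynomial at a point of the plane. -/
def pev (P : Poly2) (p : ℝ × ℝ) : ℝ := MvPolynomial.eval ![p.1, p.2] P

/-- The circle polynomial `f(x,y) = (x−a)² + (y−b)² − ρ²`. -/
def fpoly (c : ℝ × ℝ) (ρ : ℝ) : Poly2 :=
  (X 0 - MvPolynomial.C c.1) ^ 2 + (X 1 - MvPolynomial.C c.2) ^ 2 - MvPolynomial.C (ρ ^ 2)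

/-- The divergence `∂P/∂x + ∂Q/∂y` of the vector field `X = P ∂ₓ + Q ∂ᵧ`. -/
def divPoly (P Q : Poly2) : Poly2 := pderiv 0 P + pderiv 1 Q

/-- `γ : ℝ → ℝ²` is a (C¹) solution of the vector field `X = P ∂ₓ + Q ∂ᵧ`. -/
def IsSolution (P Q : Poly2) (γ : ℝ → ℝ × ℝ) : Prop :=
  ∀ t, HasDerivAt γ (pev P (γ t), pev Q (γ t)) t

/-- `S` is a periodic orbit of `X = P ∂ₓ + Q ∂ᵧ`: the image of a nonconstant periodic solution. -/
def IsPeriodicOrbit (P Q : Poly2) (S : Set (ℝ × ℝ)) : Prop :=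
  ∃ γ : ℝ → ℝ × ℝ, ∃ T : ℝ, 0 < T ∧ IsSolution P Q γ ∧ Function.Periodic γ T ∧
    (∃ t₀ t₁, γ t₀ ≠ γ t₁) ∧ Set.range γ = S

/-- `S` is a limit cycle: a periodic orbit with a neighborhood meeting no other periodic orbit. -/
def IsLimitCycle (P Q : Poly2) (S : Set (ℝ × ℝ)) : Prop :=
  IsPeriodicOrbit P Q S ∧
  ∃ U : Set (ℝ × ℝ), IsOpen U ∧ S ⊆ U ∧
    ∀ S', IsPeriodicOrbit P Q S' → S' ≠ S → Disjoint S' U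

/-- `T` is the least positive period of `γ`. -/
def IsLeastPeriod (γ : ℝ → ℝ × ℝ) (T : ℝ) : Prop :=
  0 < T ∧ Function.Periodic γ T ∧ ∀ T', 0 < T' → Function.Periodic γ T' → T ≤ T'

/-- The (limit) cycle `S` has least period `T`: it is parametrized by a solution of least
period `T`. -/
def HasLeastPeriodCycle (P Q : Poly2) (S : Set (ℝ × ℝ)) (T : ℝ) : Prop :=
  ∃ γ : ℝ → ℝ × ℝ, IsSolution P Q γ ∧ Set.range γ = S ∧ IsLeastPeriod γ T

/-- `V` is a (polynomial) inverse integrating factor of `X = P ∂ₓ + Q ∂ᵧ`: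
`P ∂V/∂x + Q ∂V/∂y = V (∂P/∂x + ∂Q/∂y)`. -/
def IsInvFactor (P Q V : Poly2) : Prop :=
  P * pderiv 0 V + Q * pderiv 1 V = V * divPoly P Q

/-- An embedded closed curve in the plane: a set homeomorphic to the circle. -/
def IsCycle (S : Set (ℝ × ℝ)) : Prop :=
  Nonempty (S ≃ₜ Metric.sphere (0 : ℝ × ℝ) 1)

/-- The compact region `D_C` bounded by a closed curve `C`: the curve together with the
points of the complement whose connected component in the complement is bounded. -/
def encDisk (S : Set (ℝ × ℝ)) : Set (ℝ × ℝ) :=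
  S ∪ {p | p ∉ S ∧ Bornology.IsBounded (connectedComponentIn Sᶜ p)}

/-- `C_k` is a primary cycle of the configuration `Γ`: no other `C_j` is contained in `D_{C_k}`. -/
def PrimaryCycle {n : ℕ} (Γ : Fin n → Set (ℝ × ℝ)) (k : Fin n) : Prop :=
  ∀ j, j ≠ k → ¬ Γ j ⊆ encDisk (Γ k)

/-- The limit cycle `S`, with enclosed region `D`, is stable in the interior for
`X = P ∂ₓ + Q ∂ᵧ`: every solution starting in the bounded region enclosed by `S`
sufficiently close to `S` converges to `S` as `t → +∞`. -/
def InteriorStable (P Q : Poly2) (S D : Set (ℝ × ℝ)) : Prop :=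
  ∃ U : Set (ℝ × ℝ), IsOpen U ∧ S ⊆ U ∧
    ∀ γ : ℝ → ℝ × ℝ, IsSolution P Q γ → γ 0 ∈ (D \ S) ∩ U →
      Filter.Tendsto (fun t => Metric.infDist (γ t) S) Filter.atTop (nhds 0)

/-- The limit cycle `S`, with enclosed region `D`, is unstable in the interior:
every solution starting in the bounded region enclosed by `S` sufficiently close to `S`
converges to `S` as `t → −∞`. -/
def InteriorUnstable (P Q : Poly2) (S D : Set (ℝ × ℝ)) : Prop :=
  ∃ U : Set (ℝ × ℝ), IsOpen U ∧ S ⊆ U ∧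
    ∀ γ : ℝ → ℝ × ℝ, IsSolution P Q γ → γ 0 ∈ (D \ S) ∩ U →
      Filter.Tendsto (fun t => Metric.infDist (γ t) S) Filter.atBot (nhds 0)

/-- The polynomial `g(x,y) = (x−a)² + (y−b)²`. -/
def gpoly (c : ℝ × ℝ) : Poly2 :=
  (X 0 - MvPolynomial.C c.1) ^ 2 + (X 1 - MvPolynomial.C c.2) ^ 2

variable {n : ℕ}

/-- `f_k(x,y) = (x−x_k)² + (y−y_k)² − r_k²`. -/
def fk (ctr : Fin n → ℝ × ℝ) (rad : Fin n → ℝ) (k : Fin n) : Poly2 :=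
  fpoly (ctr k) (rad k)

/-- The circle `C_k = f_k⁻¹(0)`. -/
def Ccir (ctr : Fin n → ℝ × ℝ) (rad : Fin n → ℝ) (k : Fin n) : Set (ℝ × ℝ) :=
  {p : ℝ × ℝ | pev (fk ctr rad k) p = 0}

/-- The closed disc `D_{C_k}` bounded by the circle `C_k`. -/
def Ddisc (ctr : Fin n → ℝ × ℝ) (rad : Fin n → ℝ) (k : Fin n) : Set (ℝ × ℝ) :=
  {p : ℝ × ℝ | (p.1 - (ctr k).1) ^ 2 + (p.2 - (ctr k).2) ^ 2 ≤ (rad k) ^ 2}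

/-- `C_k` is primary: no other circle `C_j` is contained in `D_{C_k}`. -/
def Primary (ctr : Fin n → ℝ × ℝ) (rad : Fin n → ℝ) (k : Fin n) : Prop :=
  ∀ j, j ≠ k → ¬ Ccir ctr rad j ⊆ Ddisc ctr rad k

/-- `A = ∏_{k=1}^n f_k`. -/
def Apoly (ctr : Fin n → ℝ × ℝ) (rad : Fin n → ℝ) : Poly2 := ∏ k, fk ctr rad k

/-- `B = ∏_{k=1}^r g_k` (product over the primary indices, i.e. those with `k < r`). -/
def Bpoly (r : ℕ) (ctr : Fin n → ℝ × ℝ) : Poly2 :=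
  ∏ k ∈ Finset.univ.filter (fun k : Fin n => (k : ℕ) < r), gpoly (ctr k)

/-- `μ_k = ∏_{j≠k} f_j`. -/
def muk (ctr : Fin n → ℝ × ℝ) (rad : Fin n → ℝ) (k : Fin n) : Poly2 :=
  ∏ j ∈ Finset.univ.erase k, fk ctr rad j

/-- `P_T = A(∂B/∂x − ∂B/∂y) − B Σ_k τ_k μ_k ∂f_k/∂y`. -/
def PT (r : ℕ) (ctr : Fin n → ℝ × ℝ) (rad τ : Fin n → ℝ) : Poly2 :=
  Apoly ctr rad * (pderiv 0 (Bpoly r ctr) - pderiv 1 (Bpoly r ctr)) -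
    Bpoly r ctr * ∑ k, MvPolynomial.C (τ k) * muk ctr rad k * pderiv 1 (fk ctr rad k)

/-- `Q_T = A(∂B/∂x + ∂B/∂y) + B Σ_k τ_k μ_k ∂f_k/∂x`. -/
def QT (r : ℕ) (ctr : Fin n → ℝ × ℝ) (rad τ : Fin n → ℝ) : Poly2 :=
  Apoly ctr rad * (pderiv 0 (Bpoly r ctr) + pderiv 1 (Bpoly r ctr)) +
    Bpoly r ctr * ∑ k, MvPolynomial.C (τ k) * muk ctr rad k * pderiv 0 (fk ctr rad k)

/-- `N_k`: the number of circles `C_j`, `j ≠ k`, whose bounded disc contains `C_k`. -/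
def Nk (ctr : Fin n → ℝ × ℝ) (rad : Fin n → ℝ) (k : Fin n) : ℕ :=
  Nat.card {j : Fin n // j ≠ k ∧ Ccir ctr rad k ⊆ Ddisc ctr rad j}

/-- `s_k`: the number of primary circles contained in the closed disc `D_{C_k}`. -/
def sk (r : ℕ) (ctr : Fin n → ℝ × ℝ) (rad : Fin n → ℝ) (k : Fin n) : ℕ :=
  Nat.card {j : Fin n // (j : ℕ) < r ∧ Ccir ctr rad j ⊆ Ddisc ctr rad k}

section Evaluation

lemma pev_mul (P Q : Poly2) (p : ℝ × ℝ) : pev (P * Q) p = pev P p * pev Q p :=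
  map_mul _ P Q

lemma pev_add (P Q : Poly2) (p : ℝ × ℝ) : pev (P + Q) p = pev P p + pev Q p :=
  map_add _ P Q

lemma pev_sub (P Q : Poly2) (p : ℝ × ℝ) : pev (P - Q) p = pev P p - pev Q p :=
  map_sub _ P Q

lemma pev_C (a : ℝ) (p : ℝ × ℝ) : pev (MvPolynomial.C a) p = a :=
  MvPolynomial.eval_C a

lemma pev_sum {ι : Type*} (s : Finset ι) (P : ι → Poly2) (p : ℝ × ℝ) :
    pev (∑ k ∈ s, P k) p = ∑ k ∈ s, pev (P k) p :=
  map_sum _ P s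

lemma pev_prod {ι : Type*} (s : Finset ι) (P : ι → Poly2) (p : ℝ × ℝ) :
    pev (∏ k ∈ s, P k) p = ∏ k ∈ s, pev (P k) p :=
  map_prod _ P s

lemma pev_gpoly (c p : ℝ × ℝ) : pev (gpoly c) p = (p.1 - c.1) ^ 2 + (p.2 - c.2) ^ 2 := by
  simp [pev, gpoly]

lemma pev_pderiv_zero_gpoly (c p : ℝ × ℝ) :
    pev (pderiv 0 (gpoly c)) p = 2 * (p.1 - c.1) := by
  simp [pev, gpoly, pderiv_X, Derivation.leibniz_pow]

lemma pev_pderiv_one_gpoly (c p : ℝ × ℝ) :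
    pev (pderiv 1 (gpoly c)) p = 2 * (p.2 - c.2) := by
  simp [pev, gpoly, pderiv_X, Derivation.leibniz_pow]

lemma pev_gpoly_ne_zero {c p : ℝ × ℝ} (h : p ≠ c) : pev (gpoly c) p ≠ 0 := by
  rw [pev_gpoly]
  contrapose! h
  ext <;> nlinarith [sq_nonneg (p.1 - c.1), sq_nonneg (p.2 - c.2)]

/-- The logarithmic derivative of a product of polynomials. -/
lemma pev_pderiv_prod {ι : Type*} (s : Finset ι) (P : ι → Poly2) (i : Fin 2) (p : ℝ × ℝ)
    (h : ∀ k ∈ s, pev (P k) p ≠ 0) :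
    pev (pderiv i (∏ k ∈ s, P k)) p =
      (∏ k ∈ s, pev (P k) p) * ∑ k ∈ s, pev (pderiv i (P k)) p / pev (P k) p := by
  induction s using Finset.induction_on with
  | empty => simp [pev]
  | insert a s ha ih =>
    have h0 := h a (Finset.mem_insert_self a s)
    rw [Finset.prod_insert ha, Finset.prod_insert ha, Finset.sum_insert ha, pderiv_mul, pev_add,
      pev_mul, pev_mul, ih fun k hk => h k (Finset.mem_insert_of_mem hk), pev_prod]
    field_simp

/-- The chain rule for a polynomial along a plane curve. -/
lemma HasDerivAt.pev {u v : ℝ → ℝ} {u' v' t : ℝ} (hu : HasDerivAt u u' t)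
    (hv : HasDerivAt v v' t) (P : Poly2) :
    HasDerivAt (fun t => pev P (u t, v t))
      (pev (pderiv 0 P) (u t, v t) * u' + pev (pderiv 1 P) (u t, v t) * v') t := by
  induction P using MvPolynomial.induction_on with
  | C a => simpa [_root_.pev] using hasDerivAt_const t a
  | add P Q hP hQ =>
    simp only [pev_add, map_add]
    exact (hP.add hQ).congr_deriv (by ring)
  | mul_X P i hP =>
    simp only [pev_mul, pev_add, pderiv_mul]
    fin_cases i
    · refine (hP.mul (hu.congr_of_eventuallyEq (.of_forall fun s => ?_))).congr_deriv ?_ <;>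
        simp [_root_.pev, pderiv_X]
      ring
    · refine (hP.mul (hv.congr_of_eventuallyEq (.of_forall fun s => ?_))).congr_deriv ?_ <;>
        simp [_root_.pev, pderiv_X]
      ring

end Evaluation

/-- The integrand of the line integral is twice the sum of the angular forms minus
a logarithmic differential. -/
lemma line_integrand_eq (r : ℕ) (ctr : Fin n → ℝ × ℝ) (rad τ : Fin n → ℝ) (p : ℝ × ℝ)
    (hp : ∀ k, pev (fk ctr rad k) p ≠ 0 ∧ p ≠ ctr k) (a b : ℝ) :
    (-(pev (QT r ctr rad τ) p) * a + pev (PT r ctr rad τ) p * b) /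
        (pev (Apoly ctr rad) p * pev (Bpoly r ctr) p) =
      2 * ∑ j ∈ Finset.univ.filter (fun j : Fin n => (j : ℕ) < r),
          ((p.1 - (ctr j).1) * b - (p.2 - (ctr j).2) * a) / pev (gpoly (ctr j)) p -
        ((pev (pderiv 0 (Bpoly r ctr)) p * a + pev (pderiv 1 (Bpoly r ctr)) p * b) /
            pev (Bpoly r ctr) p +
          ∑ k, τ k * ((pev (pderiv 0 (fk ctr rad k)) p * a +
            pev (pderiv 1 (fk ctr rad k)) p * b) / pev (fk ctr rad k) p)) := by
  have hA : pev (Apoly ctr rad) p ≠ 0 := by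
    rw [Apoly, pev_prod]
    exact Finset.prod_ne_zero_iff.2 fun k _ => (hp k).1
  have hB : pev (Bpoly r ctr) p ≠ 0 := by
    rw [Bpoly, pev_prod]
    exact Finset.prod_ne_zero_iff.2 fun k _ => pev_gpoly_ne_zero (hp k).2
  have hBi (i : Fin 2) : pev (pderiv i (Bpoly r ctr)) p = pev (Bpoly r ctr) p *
      ∑ k ∈ Finset.univ.filter (fun k : Fin n => (k : ℕ) < r),
        pev (pderiv i (gpoly (ctr k))) p / pev (gpoly (ctr k)) p := by
    rw [Bpoly, pev_pderiv_prod _ _ _ _ fun k _ => pev_gpoly_ne_zero (hp k).2, pev_prod]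
  have hμ (i : Fin 2) : pev (∑ k, MvPolynomial.C (τ k) * muk ctr rad k *
      pderiv i (fk ctr rad k)) p = pev (Apoly ctr rad) p *
        ∑ k, τ k * (pev (pderiv i (fk ctr rad k)) p / pev (fk ctr rad k) p) := by
    rw [pev_sum, Finset.mul_sum]
    refine Finset.sum_congr rfl fun k _ => ?_
    have hk := (hp k).1
    rw [Apoly, ← Finset.mul_prod_erase Finset.univ _ (Finset.mem_univ k), pev_mul, pev_mul,
      pev_mul, pev_C, muk]
    field_simp
  have hθ : 2 * ∑ j ∈ Finset.univ.filter (fun j : Fin n => (j : ℕ) < r),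
      ((p.1 - (ctr j).1) * b - (p.2 - (ctr j).2) * a) / pev (gpoly (ctr j)) p =
      (∑ k ∈ Finset.univ.filter (fun k : Fin n => (k : ℕ) < r),
        pev (pderiv 0 (gpoly (ctr k))) p / pev (gpoly (ctr k)) p) * b -
      (∑ k ∈ Finset.univ.filter (fun k : Fin n => (k : ℕ) < r),
        pev (pderiv 1 (gpoly (ctr k))) p / pev (gpoly (ctr k)) p) * a := by
    rw [Finset.mul_sum, Finset.sum_mul, Finset.sum_mul, ← Finset.sum_sub_distrib]
    refine Finset.sum_congr rfl fun k _ => ?_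
    rw [pev_pderiv_zero_gpoly, pev_pderiv_one_gpoly]
    ring
  have hτ : ∑ k, τ k * ((pev (pderiv 0 (fk ctr rad k)) p * a +
      pev (pderiv 1 (fk ctr rad k)) p * b) / pev (fk ctr rad k) p) =
      (∑ k, τ k * (pev (pderiv 0 (fk ctr rad k)) p / pev (fk ctr rad k) p)) * a +
      (∑ k, τ k * (pev (pderiv 1 (fk ctr rad k)) p / pev (fk ctr rad k) p)) * b := by
    rw [Finset.sum_mul, Finset.sum_mul, ← Finset.sum_add_distrib]
    exact Finset.sum_congr rfl fun k _ => by ring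
  rw [hθ, hτ, PT, QT, pev_sub, pev_add, pev_mul, pev_mul, pev_mul, pev_mul, hμ, hμ, pev_sub,
    pev_add, hBi, hBi]
  field_simp
  ring

/-- The line integral of `(−Q_T dx + P_T dy)/(AB)` along a `C¹` closed curve is twice the sum of
the line integrals of the angular forms at the primary centers. -/
lemma line_integral_eq_two_mul_sum (r : ℕ) (ctr : Fin n → ℝ × ℝ) (rad τ : Fin n → ℝ)
    (u v u' v' : ℝ → ℝ)
    (hu : ∀ t ∈ Set.Icc (0:ℝ) 1, HasDerivAt u (u' t) t)
    (hv : ∀ t ∈ Set.Icc (0:ℝ) 1, HasDerivAt v (v' t) t)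
    (hu' : ContinuousOn u' (Set.Icc (0:ℝ) 1))
    (hv' : ContinuousOn v' (Set.Icc (0:ℝ) 1))
    (hclosed : u 0 = u 1 ∧ v 0 = v 1)
    (havoid : ∀ t ∈ Set.Icc (0:ℝ) 1, ∀ k,
      pev (fk ctr rad k) (u t, v t) ≠ 0 ∧ (u t, v t) ≠ ctr k) :
    (∫ t in (0:ℝ)..1,
        (-(pev (QT r ctr rad τ) (u t, v t)) * u' t + pev (PT r ctr rad τ) (u t, v t) * v' t) /
          (pev (Apoly ctr rad) (u t, v t) * pev (Bpoly r ctr) (u t, v t)))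
      = 2 * ∑ j ∈ Finset.univ.filter (fun j : Fin n => (j : ℕ) < r),
          ∫ t in (0:ℝ)..1,
            ((u t - (ctr j).1) * v' t - (v t - (ctr j).2) * u' t) /
              pev (gpoly (ctr j)) (u t, v t) := by
  have hI : Set.uIcc (0:ℝ) 1 = Set.Icc 0 1 := Set.uIcc_of_le zero_le_one
  have hcu : ContinuousOn u (Set.Icc (0:ℝ) 1) := HasDerivAt.continuousOn hu
  have hcv : ContinuousOn v (Set.Icc (0:ℝ) 1) := HasDerivAt.continuousOn hv
  have hcont (P : Poly2) : ContinuousOn (fun t => pev P (u t, v t)) (Set.Icc (0:ℝ) 1) :=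
    HasDerivAt.continuousOn fun t ht => (hu t ht).pev (hv t ht) P
  have hg (j : Fin n) : ∀ t ∈ Set.Icc (0:ℝ) 1, pev (gpoly (ctr j)) (u t, v t) ≠ 0 :=
    fun t ht => pev_gpoly_ne_zero (havoid t ht j).2
  have hB : ∀ t ∈ Set.Icc (0:ℝ) 1, pev (Bpoly r ctr) (u t, v t) ≠ 0 := fun t ht => by
    rw [Bpoly, pev_prod]
    exact Finset.prod_ne_zero_iff.2 fun k _ => hg k t ht
  have hdlog (P : Poly2) (hP : ∀ t ∈ Set.Icc (0:ℝ) 1, pev P (u t, v t) ≠ 0) :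
      ContinuousOn (fun t => (pev (pderiv 0 P) (u t, v t) * u' t +
        pev (pderiv 1 P) (u t, v t) * v' t) / pev P (u t, v t)) (Set.Icc (0:ℝ) 1) :=
    (((hcont _).mul hu').add ((hcont _).mul hv')).div (hcont P) hP
  have hθ (j : Fin n) : IntervalIntegrable (fun t => ((u t - (ctr j).1) * v' t -
      (v t - (ctr j).2) * u' t) / pev (gpoly (ctr j)) (u t, v t)) MeasureTheory.volume 0 1 := by
    refine ContinuousOn.intervalIntegrable ?_
    rw [hI]
    exact (((hcu.sub continuousOn_const).mul hv').sub
      ((hcv.sub continuousOn_const).mul hu')).div (hcont _) (hg j)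
  have hsum : IntervalIntegrable (fun t =>
      2 * ∑ j ∈ Finset.univ.filter (fun j : Fin n => (j : ℕ) < r), ((u t - (ctr j).1) * v' t -
        (v t - (ctr j).2) * u' t) / pev (gpoly (ctr j)) (u t, v t)) MeasureTheory.volume 0 1 := by
    simpa only [Finset.sum_apply] using (IntervalIntegrable.sum _ fun j _ => hθ j).const_mul 2
  have hL : IntervalIntegrable (fun t =>
      (pev (pderiv 0 (Bpoly r ctr)) (u t, v t) * u' t +
        pev (pderiv 1 (Bpoly r ctr)) (u t, v t) * v' t) / pev (Bpoly r ctr) (u t, v t) +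
      ∑ k, τ k * ((pev (pderiv 0 (fk ctr rad k)) (u t, v t) * u' t +
        pev (pderiv 1 (fk ctr rad k)) (u t, v t) * v' t) / pev (fk ctr rad k) (u t, v t)))
      MeasureTheory.volume 0 1 := by
    refine ContinuousOn.intervalIntegrable ?_
    rw [hI]
    exact (hdlog _ hB).add (continuousOn_finsetSum _ fun k _ =>
      continuousOn_const.mul (hdlog _ fun t ht => (havoid t ht k).1))
  have hexact := intervalIntegral.integral_eq_sub_of_hasDerivAt
    (f := fun t => Real.log (pev (Bpoly r ctr) (u t, v t)) +
      ∑ k, τ k * Real.log (pev (fk ctr rad k) (u t, v t)))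
    (fun t ht => by
      rw [hI] at ht
      exact (((hu t ht).pev (hv t ht) _).log (hB t ht)).add (HasDerivAt.fun_sum fun k _ =>
        (((hu t ht).pev (hv t ht) _).log (havoid t ht k).1).const_mul (τ k))) hL
  simp only [hclosed.1, hclosed.2, sub_self] at hexact
  rw [intervalIntegral.integral_congr fun t ht =>
    line_integrand_eq r ctr rad τ (u t, v t) (havoid t (hI ▸ ht)) (u' t) (v' t),
    intervalIntegral.integral_sub hsum hL, hexact, sub_zero,
    intervalIntegral.integral_const_mul, intervalIntegral.integral_finsetSum fun j _ => hθ j]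

/-- The integral of `(z - w)⁻¹` over a circle that does not pass through `w`. -/
lemma circleIntegral_sub_inv {c w : ℂ} {R : ℝ} (hR : 0 ≤ R) (hw : dist w c ≠ R) :
    (∮ z in C(c, R), (z - w)⁻¹) = if dist w c < R then 2 * π * Complex.I else 0 := by
  split_ifs with h
  · exact circleIntegral.integral_sub_inv_of_mem_ball h
  · have hne : ∀ z ∈ Metric.closedBall c R, z - w ≠ 0 := by
      rintro z hz h0
      rw [← sub_eq_zero.1 h0] at hw h
      exact h (lt_of_le_of_ne hz hw)
    refine Complex.circleIntegral_eq_zero_of_differentiable_on_off_countable hR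
      Set.countable_empty ?_ fun z hz => ?_
    · exact (continuousOn_id.sub continuousOn_const).inv₀ hne
    · exact (differentiableAt_id.sub_const w).inv (hne z (Metric.ball_subset_closedBall hz.1))

/-- The angular form at a point integrates over a counterclockwise circle avoiding that point to
`2π` or `0`, according to whether the point lies inside the circle. -/
lemma integral_angular_form_circle (a b ρ : ℝ) (hρ : 0 < ρ) (c : ℝ × ℝ)
    (hc : (c.1 - a) ^ 2 + (c.2 - b) ^ 2 ≠ ρ ^ 2) :
    (∫ t in (0:ℝ)..1,
      ((a + ρ * Real.cos (2 * π * t) - c.1) * (2 * π * ρ * Real.cos (2 * π * t)) -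
        (b + ρ * Real.sin (2 * π * t) - c.2) * (-(2 * π * ρ) * Real.sin (2 * π * t))) /
      pev (gpoly c) (a + ρ * Real.cos (2 * π * t), b + ρ * Real.sin (2 * π * t))) =
      if (c.1 - a) ^ 2 + (c.2 - b) ^ 2 < ρ ^ 2 then 2 * π else 0 := by
  have hdist : dist (⟨c.1, c.2⟩ : ℂ) ⟨a, b⟩ ^ 2 = (c.1 - a) ^ 2 + (c.2 - b) ^ 2 := by
    rw [Complex.dist_eq_re_im, Real.sq_sqrt (by positivity)]
  have hw : dist (⟨c.1, c.2⟩ : ℂ) ⟨a, b⟩ ≠ ρ := by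
    rintro h
    exact hc (by rw [← hdist, h])
  have hlt : dist (⟨c.1, c.2⟩ : ℂ) ⟨a, b⟩ < ρ ↔ (c.1 - a) ^ 2 + (c.2 - b) ^ 2 < ρ ^ 2 := by
    rw [← hdist, sq_lt_sq₀ dist_nonneg hρ.le]
  have hint : CircleIntegrable (fun z : ℂ => (z - ⟨c.1, c.2⟩)⁻¹) ⟨a, b⟩ ρ := by
    refine ContinuousOn.circleIntegrable hρ.le
      ((continuousOn_id.sub continuousOn_const).inv₀ fun z hz h0 => hw ?_)
    rwa [Metric.mem_sphere, show z = ⟨c.1, c.2⟩ from sub_eq_zero.1 h0] at hz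
  have him := congrArg Complex.im (circleIntegral_sub_inv hρ.le hw)
  rw [circleIntegral, ← Complex.imCLM_apply,
    ← Complex.imCLM.intervalIntegral_comp_comm hint.out] at him
  have hrescale := intervalIntegral.mul_integral_comp_mul_left (a := 0) (b := 1) (c := 2 * π)
    (f := fun θ => Complex.imCLM (deriv (circleMap ⟨a, b⟩ ρ) θ •
      (circleMap ⟨a, b⟩ ρ θ - ⟨c.1, c.2⟩)⁻¹))
  rw [mul_zero, mul_one, him, ← intervalIntegral.integral_const_mul] at hrescale
  calc _ = _ := intervalIntegral.integral_congr fun t _ => ?_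
    _ = _ := hrescale
    _ = _ := by
      simp only [hlt]
      split_ifs <;> simp
  simp only [pev_gpoly, deriv_circleMap, circleMap, Complex.imCLM_apply, smul_eq_mul,
    Complex.mul_im, Complex.mul_re, Complex.inv_re, Complex.inv_im, Complex.normSq_apply,
    Complex.exp_ofReal_mul_I_re, Complex.exp_ofReal_mul_I_im, Complex.add_re, Complex.add_im,
    Complex.sub_re, Complex.sub_im, Complex.ofReal_re, Complex.ofReal_im, Complex.I_re,
    Complex.I_im, Complex.zero_re, Complex.zero_im]
  ring

/-- A point at distance `ρ` from `(a, b)` is attained by the standard parametrization of the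
circle. -/
lemma exists_circle_param_eq {a b ρ : ℝ} {c : ℝ × ℝ}
    (hc : (c.1 - a) ^ 2 + (c.2 - b) ^ 2 = ρ ^ 2) :
    ∃ t ∈ Set.Icc (0:ℝ) 1,
      (a + ρ * Real.cos (2 * π * t), b + ρ * Real.sin (2 * π * t)) = c := by
  have hmem : (⟨c.1, c.2⟩ : ℂ) ∈ Metric.sphere (⟨a, b⟩ : ℂ) |ρ| := by
    rw [Metric.mem_sphere, Complex.dist_eq_re_im, hc, Real.sqrt_sq_eq_abs]
  rw [← image_circleMap_Ioc] at hmem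
  obtain ⟨θ, hθ, h⟩ := hmem
  refine ⟨θ / (2 * π), ⟨div_nonneg hθ.1.le two_pi_pos.le,
    (div_le_one two_pi_pos).2 hθ.2⟩, ?_⟩
  rw [mul_div_cancel₀ θ two_pi_pos.ne']
  have hre := congrArg Complex.re h
  have him := congrArg Complex.im h
  simp [circleMap, Complex.exp_ofReal_mul_I_re, Complex.exp_ofReal_mul_I_im] at hre him
  exact Prod.ext hre him

/-- For any C¹ closed curve `γ = (u,v) : [0,1] → ℝ²` avoiding all circles
`C_k` and all centers `p_k`, the line integral of the 1-form `ω_T/(AB) = (−Q_T dx + P_T dy)/(AB)`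
along `γ` equals `2 Σ_{j=1}^r ∮ dθ_j`; in particular, along a counterclockwise round circle
whose open disc contains exactly `s` of the primary centers, it equals `4πs`. -/
theorem line_integral_XT
    (r : ℕ) (ctr : Fin n → ℝ × ℝ) (rad τ : Fin n → ℝ)
    (hn : 1 ≤ n) (hrn : r ≤ n) (hrad : ∀ k, 0 < rad k)
    (hdisj : ∀ j k, j ≠ k → Disjoint (Ccir ctr rad j) (Ccir ctr rad k))
    (hctr : ∀ j k, ctr j ∉ Ccir ctr rad k)
    (hprim : ∀ k, Primary ctr rad k ↔ (k : ℕ) < r)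
    (hτ : ∀ k, 0 < τ k)
    (u v u' v' : ℝ → ℝ)
    (hu : ∀ t ∈ Set.Icc (0:ℝ) 1, HasDerivAt u (u' t) t)
    (hv : ∀ t ∈ Set.Icc (0:ℝ) 1, HasDerivAt v (v' t) t)
    (hu' : ContinuousOn u' (Set.Icc (0:ℝ) 1))
    (hv' : ContinuousOn v' (Set.Icc (0:ℝ) 1))
    (hclosed : u 0 = u 1 ∧ v 0 = v 1)
    (havoid : ∀ t ∈ Set.Icc (0:ℝ) 1, ∀ k,
      pev (fk ctr rad k) (u t, v t) ≠ 0 ∧ (u t, v t) ≠ ctr k) :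
    ((∫ t in (0:ℝ)..1,
        (-(pev (QT r ctr rad τ) (u t, v t)) * u' t + pev (PT r ctr rad τ) (u t, v t) * v' t) /
          (pev (Apoly ctr rad) (u t, v t) * pev (Bpoly r ctr) (u t, v t)))
      = 2 * ∑ j ∈ Finset.univ.filter (fun j : Fin n => (j : ℕ) < r),
          ∫ t in (0:ℝ)..1,
            ((u t - (ctr j).1) * v' t - (v t - (ctr j).2) * u' t) /
              pev (gpoly (ctr j)) (u t, v t)) ∧
    -- In particular: along a counterclockwise parametrization of a round circle of center
    -- `(a,b)` and radius `ρ` avoiding all the circles `C_k` and the centers `p_k`, and whose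
    -- open disc contains exactly `s` of the primary centers, the integral equals `4πs`.
    ∀ a b ρ : ℝ, 0 < ρ →
      (∀ t ∈ Set.Icc (0:ℝ) 1, ∀ k,
        pev (fk ctr rad k) (a + ρ * Real.cos (2 * π * t), b + ρ * Real.sin (2 * π * t)) ≠ 0 ∧
        (a + ρ * Real.cos (2 * π * t), b + ρ * Real.sin (2 * π * t)) ≠ ctr k) →
      ∀ s : ℕ,
        Nat.card {j : Fin n // (j : ℕ) < r ∧
          ((ctr j).1 - a) ^ 2 + ((ctr j).2 - b) ^ 2 < ρ ^ 2} = s →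
        (∫ t in (0:ℝ)..1,
          (-(pev (QT r ctr rad τ)
                (a + ρ * Real.cos (2 * π * t), b + ρ * Real.sin (2 * π * t))) *
              (-(2 * π * ρ) * Real.sin (2 * π * t)) +
            pev (PT r ctr rad τ)
                (a + ρ * Real.cos (2 * π * t), b + ρ * Real.sin (2 * π * t)) *
              (2 * π * ρ * Real.cos (2 * π * t))) /
            (pev (Apoly ctr rad)
                (a + ρ * Real.cos (2 * π * t), b + ρ * Real.sin (2 * π * t)) *
              pev (Bpoly r ctr)
                (a + ρ * Real.cos (2 * π * t), b + ρ * Real.sin (2 * π * t))))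
          = 4 * π * s := by
  refine ⟨line_integral_eq_two_mul_sum r ctr rad τ u v u' v' hu hv hu' hv' hclosed havoid,
    fun a b ρ hρ hav s hs => ?_⟩
  have hlin (t : ℝ) : HasDerivAt (fun t : ℝ => 2 * π * t) (2 * π) t := by
    simpa using (hasDerivAt_id t).const_mul (2 * π)
  rw [line_integral_eq_two_mul_sum r ctr rad τ
    (fun t => a + ρ * Real.cos (2 * π * t)) (fun t => b + ρ * Real.sin (2 * π * t))
    (fun t => -(2 * π * ρ) * Real.sin (2 * π * t)) (fun t => 2 * π * ρ * Real.cos (2 * π * t))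
    (fun t _ => (((hlin t).cos.const_mul ρ).const_add a).congr_deriv (by ring))
    (fun t _ => (((hlin t).sin.const_mul ρ).const_add b).congr_deriv (by ring))
    (by fun_prop) (by fun_prop) (by simp) hav,
    Finset.sum_congr rfl fun j _ => integral_angular_form_circle a b ρ hρ (ctr j) fun h => by
      obtain ⟨t, ht, hct⟩ := exists_circle_param_eq h
      exact (hav t ht j).2 hct]
  rw [← Finset.sum_filter, Finset.filter_filter, Finset.sum_const, nsmul_eq_mul, ← hs,
    Nat.card_eq_fintype_card, Fintype.card_subtype]
  ring
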